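/- arXiv:1303.5203 — 4 statements merged into one kernel-verified Lean document; each statement's English description precedes it below -/
import Mathlib

section
/- For every complex z with Re z > 0 such that |exp(−z/2)·Ψ(−√z)| < |√(2πz)|, one has Ψ(√z) ≠ 0 and 1/Ψ(√z) = (1/√(2πz)) · Σ_{n=0}^∞ ((−1)ⁿ/(2π)^{n/2}) · exp(−(n+1)·z/2) · (Ψ(−√z)/√z)ⁿ, the series converging absolutely. -/
open MeasureTheory Set
open scoped Real

/-- The function `Ψ(w) = ∫₀^∞ x·exp(−x²/2 + w·x) dx`. -/
noncomputable def Psi (w : ℂ) : ℂ :=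
  ∫ x in Ioi (0:ℝ), (x:ℂ) * Complex.exp (-(x:ℂ)^2/2 + w * x)

/-- The principal branch of the complex square root. -/
noncomputable def csqrt (z : ℂ) : ℂ := z ^ (1/2 : ℂ)

lemma integrable_cexp_neg_sq_half_add (w : ℂ) :
    Integrable fun x : ℝ => Complex.exp (-(x : ℂ) ^ 2 / 2 + w * x) := by
  refine (integrable_cexp_quadratic' (b := -1 / 2) (by norm_num) w 0).congr (.of_forall fun x => ?_)
  simp only
  congr 1
  ring

lemma integrable_mul_cexp_neg_sq_half_add (w : ℂ) :
    Integrable fun x : ℝ => (x : ℂ) * Complex.exp (-(x : ℂ) ^ 2 / 2 + w * x) := by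
  refine ((integrable_cexp_neg_sq_half_add (w + 1)).norm.add
    (integrable_cexp_neg_sq_half_add (w - 1)).norm).mono'
    (by fun_prop) (.of_forall fun x => ?_)
  have hp : Complex.exp (-(x : ℂ) ^ 2 / 2 + (w + 1) * x) =
      Complex.exp x * Complex.exp (-(x : ℂ) ^ 2 / 2 + w * x) := by
    rw [← Complex.exp_add]; congr 1; ring
  have hm : Complex.exp (-(x : ℂ) ^ 2 / 2 + (w - 1) * x) =
      Complex.exp ((-x : ℝ) : ℂ) * Complex.exp (-(x : ℂ) ^ 2 / 2 + w * x) := by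
    rw [← Complex.exp_add]; congr 1; push_cast; ring
  simp only [Pi.add_apply]
  rw [hp, hm, norm_mul, norm_mul, norm_mul, ← add_mul, Complex.norm_exp_ofReal,
    Complex.norm_exp_ofReal, Complex.norm_real, Real.norm_eq_abs]
  gcongr
  rcases abs_cases x with ⟨hx, -⟩ | ⟨hx, -⟩ <;> rw [hx] <;>
    linarith [Real.add_one_le_exp x, Real.add_one_le_exp (-x), Real.exp_pos x, Real.exp_pos (-x)]

lemma integral_cexp_neg_sq_half_add (w : ℂ) :
    ∫ x : ℝ, Complex.exp (-(x : ℂ) ^ 2 / 2 + w * x) =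
      (√(2 * π) : ℂ) * Complex.exp (w ^ 2 / 2) := by
  have key := integral_cexp_quadratic (b := -1 / 2) (by norm_num) w 0
  have hsq : ((π : ℂ) / -(-1 / 2)) ^ (1 / 2 : ℂ) = (√(2 * π) : ℂ) := by
    rw [Real.sqrt_eq_rpow, Complex.ofReal_cpow (by positivity)]
    push_cast
    congr 1
    ring
  rw [hsq] at key
  convert key using 2
  · ext x
    congr 1
    ring
  · congr 1
    ring

lemma integral_mul_cexp_neg_sq_half_add (w : ℂ) :
    ∫ x : ℝ, (x : ℂ) * Complex.exp (-(x : ℂ) ^ 2 / 2 + w * x) =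
      w * ((√(2 * π) : ℂ) * Complex.exp (w ^ 2 / 2)) := by
  have hderiv (x : ℝ) : HasDerivAt (fun x : ℝ => Complex.exp (-(x : ℂ) ^ 2 / 2 + w * x))
      (w * Complex.exp (-(x : ℂ) ^ 2 / 2 + w * x) -
        (x : ℂ) * Complex.exp (-(x : ℂ) ^ 2 / 2 + w * x)) x := by
    have hid : HasDerivAt (fun x : ℝ => (x : ℂ)) 1 x := Complex.ofRealCLM.hasDerivAt
    have hexponent : HasDerivAt (fun x : ℝ => -(x : ℂ) ^ 2 / 2 + w * x) (w - x) x :=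
      (((hid.pow 2).neg.div_const 2).add (hid.const_mul w)).congr_deriv (by simp; ring)
    exact hexponent.cexp.congr_deriv (by ring)
  have hint := (integrable_cexp_neg_sq_half_add w).const_mul w
  have hzero := integral_eq_zero_of_hasDerivAt_of_integrable hderiv
    (hint.sub (integrable_mul_cexp_neg_sq_half_add w)) (integrable_cexp_neg_sq_half_add w)
  rw [integral_sub hint (integrable_mul_cexp_neg_sq_half_add w), integral_const_mul,
    integral_cexp_neg_sq_half_add] at hzero
  exact (sub_eq_zero.mp hzero).symm

lemma Psi_eq_Psi_neg_add (w : ℂ) :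
    Psi w = Psi (-w) + w * ((√(2 * π) : ℂ) * Complex.exp (w ^ 2 / 2)) := by
  have hint := integrable_mul_cexp_neg_sq_half_add w
  have hsplit := intervalIntegral.integral_Iic_add_Ioi (b := (0 : ℝ))
    hint.integrableOn hint.integrableOn
  have hneg : ∫ x in Iic (0 : ℝ), (x : ℂ) * Complex.exp (-(x : ℂ) ^ 2 / 2 + w * x) =
      -Psi (-w) := by
    rw [Psi, ← integral_neg, ← neg_zero, ← integral_comp_neg_Ioi, neg_zero]
    simp
  rw [hneg, integral_mul_cexp_neg_sq_half_add] at hsplit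
  rw [← hsplit, Psi, Psi]
  ring

lemma csqrt_sq (z : ℂ) : csqrt z ^ 2 = z := by
  simp [csqrt]

lemma csqrt_two_pi_mul {z : ℂ} (hz : z ≠ 0) : csqrt (2 * π * z) = √(2 * π) * csqrt z := by
  have hpi : (0 : ℝ) < 2 * π := by positivity
  have hcast : (2 * π : ℂ) = ((2 * π : ℝ) : ℂ) := by push_cast; rfl
  have hpi' : ((2 * π : ℝ) : ℂ) ≠ 0 := Complex.ofReal_ne_zero.mpr hpi.ne'
  rw [csqrt, csqrt, hcast, Real.sqrt_eq_rpow, Complex.ofReal_cpow hpi.le,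
    Complex.cpow_def_of_ne_zero (mul_ne_zero hpi' hz), Complex.cpow_def_of_ne_zero hpi',
    Complex.cpow_def_of_ne_zero hz, Complex.log_ofReal_mul hpi hz, ← Complex.exp_add,
    ← Complex.ofReal_log hpi.le]
  congr 1
  push_cast
  ring

/-- Geometric-series resolution of `1/Ψ(√z)`: for `Re z > 0` with
`|exp(−z/2)·Ψ(−√z)| < |√(2πz)|`, one has `Ψ(√z) ≠ 0` and
`1/Ψ(√z) = (1/√(2πz))·Σₙ ((−1)ⁿ/(2π)^{n/2})·exp(−(n+1)z/2)·(Ψ(−√z)/√z)ⁿ`,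
the series converging absolutely. -/
theorem one_div_psi_series (z : ℂ) (hz : 0 < z.re)
    (h : ‖Complex.exp (-z/2) * Psi (-csqrt z)‖ < ‖csqrt (2*π*z)‖) :
    Psi (csqrt z) ≠ 0 ∧
    1 / Psi (csqrt z) =
      (1 / csqrt (2*π*z)) * ∑' n : ℕ,
        ((-1 : ℂ)^n / ((Real.sqrt (2*π) : ℂ))^n) * Complex.exp (-((n : ℂ)+1)*z/2) *
          (Psi (-csqrt z) / csqrt z)^n ∧
    Summable (fun n : ℕ =>
      ‖((-1 : ℂ)^n / ((Real.sqrt (2*π) : ℂ))^n) * Complex.exp (-((n : ℂ)+1)*z/2) *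
          (Psi (-csqrt z) / csqrt z)^n‖) := by
  have hz0 : z ≠ 0 := fun hz0 => by simp [hz0] at hz
  have hs : csqrt z ≠ 0 := fun hs => hz0 (by rw [← csqrt_sq z, hs]; simp)
  have hS : (√(2 * π) : ℂ) ≠ 0 := Complex.ofReal_ne_zero.mpr (by positivity)
  have hPsi := Psi_eq_Psi_neg_add (csqrt z)
  rw [csqrt_sq] at hPsi
  rw [csqrt_two_pi_mul hz0] at h ⊢
  set s := csqrt z
  set S : ℂ := (√(2 * π) : ℂ)
  have hSs : S * s ≠ 0 := mul_ne_zero hS hs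
  set r : ℂ := -(Complex.exp (-z / 2) * Psi (-s) / (S * s)) with hr
  have hr1 : ‖r‖ < 1 := by
    rwa [hr, norm_neg, norm_div, div_lt_one (norm_pos_iff.mpr hSs)]
  have hterm (n : ℕ) : (-1 : ℂ) ^ n / S ^ n * Complex.exp (-((n : ℂ) + 1) * z / 2) *
      (Psi (-s) / s) ^ n = Complex.exp (-z / 2) * r ^ n := by
    have hexp : Complex.exp (-((n : ℂ) + 1) * z / 2) =
        Complex.exp (-z / 2) * Complex.exp (-z / 2) ^ n := by
      rw [← Complex.exp_nat_mul, ← Complex.exp_add]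
      congr 1
      ring
    have hr' : r = -1 / S * Complex.exp (-z / 2) * (Psi (-s) / s) := by
      rw [hr]
      field_simp
    rw [hexp, hr', mul_pow, mul_pow, div_pow]
    ring
  have hr0 : 1 - r ≠ 0 := fun h0 => by
    rw [← sub_eq_zero.mp h0, norm_one] at hr1
    exact hr1.false
  have hfactor : Psi s = S * s * Complex.exp (z / 2) * (1 - r) := by
    have hexp : Complex.exp (z / 2) * Complex.exp (-z / 2) = 1 := by
      rw [← Complex.exp_add, neg_div, add_neg_cancel, Complex.exp_zero]
    have hmul : S * s * r = -(Complex.exp (-z / 2) * Psi (-s)) := by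
      rw [hr, mul_neg, mul_div_cancel₀ _ hSs]
    linear_combination hPsi - Psi (-s) * hexp + Complex.exp (z / 2) * hmul
  simp_rw [hterm]
  refine ⟨?_, ?_, ?_⟩
  · rw [hfactor]
    exact mul_ne_zero (mul_ne_zero hSs (Complex.exp_ne_zero _)) hr0
  · rw [tsum_mul_left, tsum_geometric_of_norm_lt_one hr1, hfactor, neg_div, Complex.exp_neg]
    have := Complex.exp_ne_zero (z / 2)
    field_simp
  · exact ((summable_geometric_of_norm_lt_one hr1).mul_left _).norm
end

section
/- For every complex number w: Ψ(w) = Ψ(−w) + √(2π) · w · exp(w²/2). -/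
open MeasureTheory Set
open scoped Real

theorem integrable_cexp_neg_sq_div_two_add_mul (w : ℂ) :
    Integrable fun x : ℝ ↦ Complex.exp (-(x : ℂ) ^ 2 / 2 + w * x) := by
  convert! integrable_cexp_quadratic (b := 1 / 2) (by norm_num) w 0 using 3
  ring

theorem integral_cexp_neg_sq_div_two_add_mul (w : ℂ) :
    ∫ x : ℝ, Complex.exp (-(x : ℂ) ^ 2 / 2 + w * x) =
      (Real.sqrt (2 * π) : ℂ) * Complex.exp (w ^ 2 / 2) := by
  have h := integral_cexp_quadratic (b := -1 / 2) (by norm_num) w 0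
  have hfun : (fun x : ℝ ↦ Complex.exp (-(x : ℂ) ^ 2 / 2 + w * x)) =
      fun x : ℝ ↦ Complex.exp (-1 / 2 * (x : ℂ) ^ 2 + w * x + 0) := by
    funext x
    congr 1
    ring
  rw [hfun, h, Real.sqrt_eq_rpow, Complex.ofReal_cpow (by positivity)]
  congr 2
  · push_cast
    ring
  · push_cast
    rfl
  · ring

theorem integrable_mul_cexp_neg_sq_div_two_add_mul (w : ℂ) :
    Integrable fun x : ℝ ↦ (x : ℂ) * Complex.exp (-(x : ℂ) ^ 2 / 2 + w * x) := by
  refine ((integrable_cexp_neg_sq_div_two_add_mul (w + 1)).norm.add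
    (integrable_cexp_neg_sq_div_two_add_mul (w - 1)).norm).mono'
    (by fun_prop) (.of_forall fun x ↦ ?_)
  have h₁ : -(x : ℂ) ^ 2 / 2 + (w + 1) * x = (x : ℂ) + (-(x : ℂ) ^ 2 / 2 + w * x) := by ring
  have h₂ : -(x : ℂ) ^ 2 / 2 + (w - 1) * x = ((-x : ℝ) : ℂ) + (-(x : ℂ) ^ 2 / 2 + w * x) := by
    push_cast
    ring
  have hx : |x| ≤ Real.exp x + Real.exp (-x) :=
    abs_le'.2 ⟨by linarith [Real.add_one_le_exp x, Real.exp_pos (-x)],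
      by linarith [Real.add_one_le_exp (-x), Real.exp_pos x]⟩
  simp only [Pi.add_apply]
  rw [h₁, h₂, Complex.exp_add (x : ℂ), Complex.exp_add ((-x : ℝ) : ℂ), norm_mul, norm_mul, norm_mul,
    Complex.norm_exp_ofReal, Complex.norm_exp_ofReal, Complex.norm_real, Real.norm_eq_abs,
    ← add_mul]
  gcongr

theorem integral_mul_cexp_neg_sq_div_two_add_mul (w : ℂ) :
    ∫ x : ℝ, (x : ℂ) * Complex.exp (-(x : ℂ) ^ 2 / 2 + w * x) =
      w * ∫ x : ℝ, Complex.exp (-(x : ℂ) ^ 2 / 2 + w * x) := by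
  have hi := integrable_cexp_neg_sq_div_two_add_mul w
  have hxi := integrable_mul_cexp_neg_sq_div_two_add_mul w
  have hderiv (x : ℝ) : HasDerivAt (fun x : ℝ ↦ Complex.exp (-(x : ℂ) ^ 2 / 2 + w * x))
      (w * Complex.exp (-(x : ℂ) ^ 2 / 2 + w * x) -
        (x : ℂ) * Complex.exp (-(x : ℂ) ^ 2 / 2 + w * x)) x := by
    have hx := Complex.ofRealCLM.hasDerivAt (x := x)
    simp only [Complex.ofRealCLM_apply, Complex.ofReal_one] at hx
    convert! (((hx.pow 2).neg.div_const 2).add (hx.const_mul w)).cexp using 1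
    simp
    ring
  have h := integral_eq_zero_of_hasDerivAt_of_integrable hderiv ((hi.const_mul w).sub hxi) hi
  rw [integral_sub (hi.const_mul w) hxi, integral_const_mul] at h
  exact (sub_eq_zero.1 h).symm

theorem Psi_neg (w : ℂ) :
    Psi (-w) = -∫ x in Iic (0 : ℝ), (x : ℂ) * Complex.exp (-(x : ℂ) ^ 2 / 2 + w * x) := by
  have h := integral_comp_neg_Ioi 0
    fun x : ℝ ↦ (x : ℂ) * Complex.exp (-(x : ℂ) ^ 2 / 2 + w * x)
  rw [neg_zero] at h
  rw [← h, ← integral_neg, Psi]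
  simp

/-- Key identity: `Ψ(w) = Ψ(−w) + √(2π)·w·exp(w²/2)` for every complex `w`. -/
theorem psi_key_identity (w : ℂ) :
    Psi w = Psi (-w) + (Real.sqrt (2*π) : ℂ) * w * Complex.exp (w^2/2) := by
  have hi := integrable_mul_cexp_neg_sq_div_two_add_mul w
  have h := intervalIntegral.integral_Iic_add_Ioi (b := (0 : ℝ)) hi.integrableOn hi.integrableOn
  rw [integral_mul_cexp_neg_sq_div_two_add_mul, integral_cexp_neg_sq_div_two_add_mul] at h
  rw [Psi_neg, Psi]
  linear_combination h
end

section
/- For every complex number w: Ψ(−√2·w) = 1 − √π · w · exp(w²) · Erfc(w). -/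
open MeasureTheory Set
open scoped Real

/-- The complementary error function, extended to complex arguments:
`Erfc(ξ) = 1 − (2/√π)·∫₀^ξ exp(−x²) dx`, the integral from `0` to `ξ` being taken
along the straight-line path `t ↦ t·ξ`, `t ∈ [0,1]` (the integrand is entire, so
the path is irrelevant). -/
noncomputable def cerfc (ξ : ℂ) : ℂ :=
  1 - (2 / (Real.sqrt π : ℂ)) * ((∫ t in (0:ℝ)..1, Complex.exp (-((t:ℂ) * ξ)^2)) * ξ)

section

open Filter Topology

/-- A Gaussian with an arbitrary linear and constant term vanishes at infinity. -/
theorem tendsto_exp_neg_quadratic_atTop {b : ℝ} (hb : 0 < b) (c d : ℝ) :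
    Tendsto (fun x : ℝ => Real.exp (-b * x ^ 2 + c * x + d)) atTop (𝓝 0) := by
  refine Real.tendsto_exp_atBot.comp (tendsto_atBot_add_const_right _ d ?_)
  have h : Tendsto (fun x : ℝ => -b * x + c) atTop atBot :=
    tendsto_atBot_add_const_right _ c (tendsto_id.const_mul_atTop_of_neg (neg_lt_zero.2 hb))
  refine (tendsto_id.atTop_mul_atBot₀ h).congr fun x => ?_
  simp only [id]
  ring

/-- A complex Gaussian with a linear term, times `x`, is integrable on the half-line. -/
theorem integrableOn_Ioi_mul_cexp_quadratic (v : ℂ) :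
    IntegrableOn (fun x : ℝ => (x : ℂ) * Complex.exp (-(x : ℂ) ^ 2 / 2 + v * x)) (Ioi 0) := by
  have hint := (integrable_cexp_quadratic (b := 1 / 2) (by norm_num) (v + 1) 0).integrableOn
    (s := Ioi (0 : ℝ))
  refine Integrable.mono hint (by fun_prop) ?_
  filter_upwards [ae_restrict_mem measurableSet_Ioi] with x hx
  have hx' : ‖(x : ℂ)‖ ≤ ‖Complex.exp x‖ := by
    rw [Complex.norm_real, Real.norm_of_nonneg (le_of_lt hx), Complex.norm_exp, Complex.ofReal_re]
    linarith [Real.add_one_le_exp x]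
  calc ‖(x : ℂ) * Complex.exp (-(x : ℂ) ^ 2 / 2 + v * x)‖
      ≤ ‖Complex.exp x‖ * ‖Complex.exp (-(x : ℂ) ^ 2 / 2 + v * x)‖ := by
        rw [norm_mul]
        gcongr
    _ = ‖Complex.exp (-(1 / 2) * (x : ℂ) ^ 2 + (v + 1) * x + 0)‖ := by
        rw [← norm_mul, ← Complex.exp_add]
        congr 2
        ring

/-- Primitives of `exp (-z²)` are given by integration along segments from `0`. -/
theorem integral_cexp_neg_sq_segment {g : ℂ → ℂ}
    (hg : ∀ z, HasDerivAt g (Complex.exp (-z ^ 2)) z) (w : ℂ) :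
    (∫ t in (0 : ℝ)..1, Complex.exp (-((t : ℂ) * w) ^ 2)) * w = g w - g 0 := by
  rw [← intervalIntegral.integral_mul_const]
  have hderiv (t : ℝ) : HasDerivAt (fun t : ℝ => g ((t : ℂ) * w))
      (Complex.exp (-((t : ℂ) * w) ^ 2) * w) t := by
    have h := (hg ((t : ℂ) * w)).comp (t : ℂ) ((hasDerivAt_id (t : ℂ)).mul_const w)
    simpa using h.comp_ofReal
  rw [intervalIntegral.integral_eq_sub_of_hasDerivAt (fun t _ => hderiv t)
    (Continuous.intervalIntegrable (by fun_prop) _ _)]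
  simp

/-- The limit at `+∞` of a primitive of `exp (-z²)` along the real axis. -/
theorem tendsto_primitive_cexp_neg_sq_ofReal {g : ℂ → ℂ}
    (hg : ∀ z, HasDerivAt g (Complex.exp (-z ^ 2)) z) :
    Tendsto (fun x : ℝ => g x) atTop (𝓝 (g 0 + (√π : ℂ) / 2)) := by
  have hval : ∫ x in Ioi (0 : ℝ), Complex.exp (-(x : ℂ) ^ 2) = (√π : ℂ) / 2 := by
    have h := congrArg (fun r : ℝ => (r : ℂ)) (integral_gaussian_Ioi 1)
    rw [← integral_complex_ofReal] at h
    simpa using h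
  have hint : IntegrableOn (fun x : ℝ => Complex.exp (-(x : ℂ) ^ 2)) (Ioi 0) := by
    have h := (integrable_cexp_quadratic (b := 1) (by norm_num) 0 0).integrableOn
      (s := Ioi (0 : ℝ))
    simpa using h
  have h := (intervalIntegral_tendsto_integral_Ioi 0 hint tendsto_id).const_add (g 0)
  rw [hval] at h
  refine h.congr fun x => ?_
  rw [intervalIntegral.integral_eq_sub_of_hasDerivAt (fun t _ => (hg (t : ℂ)).comp_ofReal)
    (Continuous.intervalIntegrable (by fun_prop) _ _)]
  simp

/-- The limit at `+∞` of a primitive of `exp (-z²)` is the same along all horizontal lines. -/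
theorem tendsto_primitive_cexp_neg_sq {g : ℂ → ℂ}
    (hg : ∀ z, HasDerivAt g (Complex.exp (-z ^ 2)) z) (w : ℂ) :
    Tendsto (fun x : ℝ => g (x + w)) atTop (𝓝 (g 0 + (√π : ℂ) / 2)) := by
  have hdiff : Tendsto (fun x : ℝ => g (x + w) - g x) atTop (𝓝 0) := by
    have hlim := (tendsto_exp_neg_quadratic_atTop one_pos (2 * ‖w‖) (‖w‖ ^ 2)).mul_const ‖w‖
    rw [zero_mul] at hlim
    refine squeeze_zero_norm' ?_ hlim
    filter_upwards [eventually_ge_atTop 0] with x hx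
    have hbound : ∀ z ∈ Metric.closedBall (x : ℂ) ‖w‖, ‖Complex.exp (-z ^ 2)‖ ≤
        Real.exp (-1 * x ^ 2 + 2 * ‖w‖ * x + ‖w‖ ^ 2) := by
      intro z hz
      rw [mem_closedBall_iff_norm] at hz
      obtain ⟨u, rfl⟩ : ∃ u, z = x + u := ⟨z - x, by ring⟩
      rw [add_sub_cancel_left] at hz
      rw [Complex.norm_exp, Real.exp_le_exp]
      have hre : (-((x : ℂ) + u) ^ 2).re = -x ^ 2 - 2 * x * u.re - (u ^ 2).re := by
        simp [sq]
        ring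
      have h1 : -u.re ≤ ‖w‖ := ((neg_le_abs _).trans (Complex.abs_re_le_norm u)).trans hz
      have h2 : -(u ^ 2).re ≤ ‖w‖ ^ 2 := by
        refine ((neg_le_abs _).trans (Complex.abs_re_le_norm _)).trans ?_
        rw [norm_pow]
        gcongr
      rw [hre]
      nlinarith [mul_le_mul_of_nonneg_left h1 hx]
    have h := (convex_closedBall (x : ℂ) ‖w‖).norm_image_sub_le_of_norm_hasDerivWithin_le
      (fun z _ => (hg z).hasDerivWithinAt) hbound
      (Metric.mem_closedBall_self (norm_nonneg w)) (y := (x : ℂ) + w) (by simp)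
    simpa using h
  simpa using hdiff.add (tendsto_primitive_cexp_neg_sq_ofReal hg)

/-- Evaluation of `Psi` by a primitive of `exp (-z²)`. -/
theorem Psi_eq_primitive {g : ℂ → ℂ}
    (hg : ∀ z, HasDerivAt g (Complex.exp (-z ^ 2)) z) (w : ℂ) :
    Psi (-(√2 : ℂ) * w) =
      1 - 2 * w * Complex.exp (w ^ 2) * (g 0 + (√π : ℂ) / 2 - g w) := by
  have hsq : (√2 : ℂ) ^ 2 = 2 := by
    rw [← Complex.ofReal_pow, Real.sq_sqrt zero_le_two, Complex.ofReal_ofNat]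
  have hne : (√2 : ℂ) ≠ 0 := by
    intro h
    simp [h] at hsq
  have hinv : 1 / (√2 : ℂ) = (√2 : ℂ) / 2 := by
    field_simp
    exact hsq.symm
  set F : ℂ → ℂ := fun z => -Complex.exp (-z ^ 2 / 2 + -(√2 : ℂ) * w * z) -
    2 * w * Complex.exp (w ^ 2) * g (z / (√2 : ℂ) + w) with hF
  have hderiv (z : ℂ) :
      HasDerivAt F (z * Complex.exp (-z ^ 2 / 2 + -(√2 : ℂ) * w * z)) z := by
    have h1 : HasDerivAt (fun z : ℂ => -z ^ 2 / 2 + -(√2 : ℂ) * w * z)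
        (-z + -(√2 : ℂ) * w) z := by
      convert! (((hasDerivAt_pow 2 z).neg.div_const 2).add
        ((hasDerivAt_id z).const_mul (-(√2 : ℂ) * w))) using 1
      simp
      ring
    have h2 : HasDerivAt (fun z : ℂ => z / (√2 : ℂ) + w) (1 / (√2 : ℂ)) z :=
      ((hasDerivAt_id z).div_const _).add_const w
    have hexp : Complex.exp (w ^ 2) * Complex.exp (-(z / (√2 : ℂ) + w) ^ 2) =
        Complex.exp (-z ^ 2 / 2 + -(√2 : ℂ) * w * z) := by
      rw [← Complex.exp_add]
      congr 1
      rw [div_eq_mul_one_div z, hinv]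
      linear_combination (-z ^ 2 / 4) * hsq
    convert! h1.cexp.neg.sub
      (((hg _).comp z h2).const_mul (2 * w * Complex.exp (w ^ 2))) using 1
    rw [← hexp, hinv]
    ring
  have hlim : Tendsto (fun x : ℝ => F x) atTop
      (𝓝 (-0 - 2 * w * Complex.exp (w ^ 2) * (g 0 + (√π : ℂ) / 2))) := by
    refine Tendsto.sub (Tendsto.neg ?_) (Tendsto.const_mul _ ?_)
    · rw [tendsto_zero_iff_norm_tendsto_zero]
      refine (tendsto_exp_neg_quadratic_atTop one_half_pos (-(√2 : ℂ) * w).re 0).congr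
        fun x => ?_
      rw [Complex.norm_exp, Complex.add_re, Complex.re_mul_ofReal, ← Complex.ofReal_pow,
        Complex.div_ofNat_re, Complex.neg_re, Complex.ofReal_re]
      ring_nf
    · have h := (tendsto_primitive_cexp_neg_sq hg w).comp
        (tendsto_id.atTop_div_const (Real.sqrt_pos.2 (zero_lt_two (α := ℝ))))
      refine h.congr fun x => ?_
      simp
  rw [Psi, integral_Ioi_of_hasDerivAt_of_tendsto' (fun x _ => (hderiv x).comp_ofReal)
    (integrableOn_Ioi_mul_cexp_quadratic _) hlim]
  simp [hF]
  ring

end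

/-- Partial integration identity: `Ψ(−√2·w) = 1 − √π·w·exp(w²)·Erfc(w)` for all complex `w`. -/
theorem psi_erfc_identity (w : ℂ) :
    Psi (-(Real.sqrt 2 : ℂ) * w) = 1 - (Real.sqrt π : ℂ) * w * Complex.exp (w^2) * cerfc w := by
  obtain ⟨g, hg⟩ := (show Differentiable ℂ fun z : ℂ => Complex.exp (-z ^ 2) by
    fun_prop).isExactOn_univ
  replace hg (z : ℂ) : HasDerivAt g (Complex.exp (-z ^ 2)) z := hg z (mem_univ z)
  have hpi : (√π : ℂ) ≠ 0 := Complex.ofReal_ne_zero.2 (Real.sqrt_pos.2 Real.pi_pos).ne'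
  rw [Psi_eq_primitive hg, cerfc, integral_cexp_neg_sq_segment hg]
  field_simp
  ring
end

section
/- Let b, δ, D > 0 be real numbers and y ∈ ℝ. The function R defined on {Re z > 0} by R(z) = (√D/√z) · ∫_ℝ exp(−(|x−y|/√D)·√z) · φ_{b,δ}(x) dx satisfies R(z) = O(|z|^{−1}) as |z| → ∞ in {Re z > 0}, i.e. there exist constants C > 0 and M > 0 such that |R(z)| ≤ C/|z| for all z with Re z > 0 and |z| ≥ M. -/
open MeasureTheory Set
open scoped Real

/-- The function `φ_{b,δ}(x) = (1/√(2πδ))·(exp(−x²/(2δ)) − exp(−(x−2b)²/(2δ)))`. -/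
noncomputable def phiK (b δ x : ℝ) : ℝ :=
  (1 / Real.sqrt (2*π*δ)) * (Real.exp (-x^2/(2*δ)) - Real.exp (-(x - 2*b)^2/(2*δ)))

lemma integral_exp_neg_mul_abs_sub {a : ℝ} (ha : 0 < a) (y : ℝ) :
    ∫ x : ℝ, Real.exp (-a * |x - y|) = 2 / a := by
  rw [integral_sub_right_eq_self (fun x : ℝ => Real.exp (-a * |x|)) y,
    integral_comp_abs (f := fun t : ℝ => Real.exp (-a * t)),
    integral_exp_mul_Ioi (neg_lt_zero.mpr ha)]
  simp [div_eq_mul_inv]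

lemma integrable_exp_neg_mul_abs_sub {a : ℝ} (ha : 0 < a) (y : ℝ) :
    Integrable (fun x : ℝ => Real.exp (-a * |x - y|)) := by
  refine Integrable.of_integral_ne_zero ?_
  rw [integral_exp_neg_mul_abs_sub ha]
  positivity

lemma csqrt_re (z : ℂ) : (csqrt z).re = √((‖z‖ + z.re) / 2) := by
  rw [csqrt, one_div, Complex.cpow_inv_two_re]

lemma norm_csqrt_sq (z : ℂ) : ‖csqrt z‖ ^ 2 = ‖z‖ := by
  rw [csqrt, one_div, ← norm_pow, Complex.cpow_ofNat_inv_pow]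

lemma csqrt_re_pos {z : ℂ} (hz : 0 < z.re) : 0 < (csqrt z).re := by
  rw [csqrt_re]
  positivity

lemma norm_csqrt_le_two_mul_re {z : ℂ} (hz : 0 < z.re) : ‖csqrt z‖ ≤ 2 * (csqrt z).re := by
  have hre := csqrt_re_pos hz
  refine le_of_sq_le_sq ?_ (by positivity)
  rw [norm_csqrt_sq, mul_pow, csqrt_re, Real.sq_sqrt (by positivity)]
  linarith [norm_nonneg z]

lemma abs_phiK_le {δ : ℝ} (hδ : 0 ≤ δ) (b x : ℝ) :
    |phiK b δ x| ≤ 1 / √(2 * π * δ) := by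
  have exp_le_one (t : ℝ) : Real.exp (-t ^ 2 / (2 * δ)) ≤ 1 :=
    Real.exp_le_one_iff.mpr (div_nonpos_of_nonpos_of_nonneg (by nlinarith [sq_nonneg t])
      (by positivity))
  rw [phiK, abs_mul, abs_of_nonneg (show 0 ≤ 1 / √(2 * π * δ) by positivity)]
  refine mul_le_of_le_one_right (by positivity) (abs_le.mpr ⟨?_, ?_⟩) <;>
  linarith [exp_le_one x, exp_le_one (x - 2 * b), Real.exp_nonneg (-x ^ 2 / (2 * δ)),
    Real.exp_nonneg (-(x - 2 * b) ^ 2 / (2 * δ))]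

lemma norm_integral_exp_mul_le {c K : ℝ} (hc : 0 < c) {s : ℂ} (hs : 0 < s.re) (y : ℝ)
    {f : ℝ → ℝ} (hf : ∀ x, |f x| ≤ K) :
    ‖∫ x : ℝ, Complex.exp (-((|x - y| / c : ℝ) : ℂ) * s) * (f x : ℂ)‖ ≤
      2 * c * K / s.re := by
  have ha : 0 < s.re / c := div_pos hs hc
  calc ‖∫ x : ℝ, Complex.exp (-((|x - y| / c : ℝ) : ℂ) * s) * (f x : ℂ)‖
      ≤ ∫ x : ℝ, Real.exp (-(s.re / c) * |x - y|) * K := by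
        refine norm_integral_le_of_norm_le
          ((integrable_exp_neg_mul_abs_sub ha y).mul_const K) (ae_of_all _ fun x => ?_)
        rw [norm_mul, Complex.norm_exp, Complex.norm_real, Real.norm_eq_abs,
          ← Complex.ofReal_neg, Complex.re_ofReal_mul,
          show -(|x - y| / c) * s.re = -(s.re / c) * |x - y| by ring]
        exact mul_le_mul_of_nonneg_left (hf x) (Real.exp_nonneg _)
    _ = 2 * c * K / s.re := by
        rw [integral_mul_const, integral_exp_neg_mul_abs_sub ha]
        field_simp

/-- For `b, δ, D > 0` and `y ∈ ℝ`, the function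
`R(z) = (√D/√z)·∫_ℝ exp(−(|x−y|/√D)·√z)·φ_{b,δ}(x) dx` on `{Re z > 0}`
satisfies `R(z) = O(|z|⁻¹)` as `|z| → ∞` there: there are constants `C > 0` and `M > 0`
with `|R(z)| ≤ C/|z|` whenever `Re z > 0` and `|z| ≥ M`. -/
theorem R22_decay (b δ D : ℝ) (hb : 0 < b) (hδ : 0 < δ) (hD : 0 < D) (y : ℝ) :
    ∃ C > (0:ℝ), ∃ M > (0:ℝ), ∀ z : ℂ, 0 < z.re → M ≤ ‖z‖ →
      ‖((Real.sqrt D : ℂ) / csqrt z) * ∫ x : ℝ,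
          Complex.exp (-((|x - y| / Real.sqrt D : ℝ) : ℂ) * csqrt z) * (phiK b δ x : ℂ)‖ ≤
        C / ‖z‖ := by
  refine ⟨4 * D * (1 / √(2 * π * δ)), by positivity, 1, one_pos, fun z hz _ => ?_⟩
  have hre := csqrt_re_pos hz
  have hnorm : 0 < ‖csqrt z‖ := hre.trans_le (Complex.re_le_norm _)
  rw [norm_mul, norm_div, Complex.norm_real, Real.norm_of_nonneg (Real.sqrt_nonneg D)]
  calc √D / ‖csqrt z‖ * ‖_‖
      ≤ √D / ‖csqrt z‖ * (2 * √D * (1 / √(2 * π * δ)) / (csqrt z).re) :=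
        mul_le_mul_of_nonneg_left (norm_integral_exp_mul_le (Real.sqrt_pos.mpr hD) hre y
          (abs_phiK_le hδ.le b)) (by positivity)
    _ ≤ √D / ‖csqrt z‖ * (2 * √D * (1 / √(2 * π * δ)) / (‖csqrt z‖ / 2)) := by
        gcongr
        linarith [norm_csqrt_le_two_mul_re hz]
    _ = 4 * √D ^ 2 * (1 / √(2 * π * δ)) / ‖csqrt z‖ ^ 2 := by
        field_simp
        norm_num
    _ = 4 * D * (1 / √(2 * π * δ)) / ‖z‖ := by
        rw [Real.sq_sqrt hD.le, norm_csqrt_sq]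
end
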